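/- arXiv:1911.06139 — 5 statements merged into one kernel-verified Lean document; each statement's English description precedes it below -/
import Mathlib

section
/- Let n ≥ 2 and let A = [a_{ij}] be a real n×n matrix with constant row sums, with trivial eigenvalue λ_A equal to the common row sum. Then τ_1(A) = (1/2) · max_{i,j} Σ_{k=1}^n |a_{ik} − a_{jk}|, and moreover this quantity also equals λ_A − min_{i,j} Σ_{k=1}^n min{a_{ik}, a_{jk}}. -/
open Matrix Polynomial Filter
open scoped ENNReal

/-- The `l_p` norm of a vector in `ℝⁿ`, for `p ∈ [0,∞]`. -/
noncomputable def lpNorm (p : ℝ≥0∞) {n : ℕ} (x : Fin n → ℝ) : ℝ :=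
  ‖(WithLp.equiv p (Fin n → ℝ)).symm x‖

/-- The vector-norm based ergodicity coefficient `τ_p(A)`. -/
noncomputable def tau (p : ℝ≥0∞) {n : ℕ} (A : Matrix (Fin n) (Fin n) ℝ) : ℝ :=
  sSup {y : ℝ | ∃ x : Fin n → ℝ, (∑ i, x i) = 0 ∧ lpNorm p x = 1 ∧ y = lpNorm p (Aᵀ *ᵥ x)}

/-- The all-ones matrix `J`. -/
def allOnes (n : ℕ) : Matrix (Fin n) (Fin n) ℝ := Matrix.of fun _ _ => 1

lemma lpNorm_one_eq_sum {n : ℕ} (x : Fin n → ℝ) : lpNorm 1 x = ∑ i, |x i| := by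
  simp [lpNorm, PiLp.norm_eq_of_L1]

/-- On vectors whose coordinates sum to zero, `x ↦ ‖Aᵀx‖₁` is bounded by half the largest
`l₁` distance between rows of `A`, relative to `‖x‖₁`. -/
lemma sum_abs_transpose_mulVec_le {n : ℕ} (A : Matrix (Fin n) (Fin n) ℝ) {M : ℝ}
    (hM : ∀ i j, ∑ k, |A i k - A j k| ≤ M) {x : Fin n → ℝ} (hx : ∑ i, x i = 0)
    (hx1 : ∑ i, |x i| = 1) : ∑ k, |(Aᵀ *ᵥ x) k| ≤ 1 / 2 * M := by
  set p : Fin n → ℝ := fun i => (|x i| + x i) / 2 with hp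
  set q : Fin n → ℝ := fun i => (|x i| - x i) / 2 with hq
  have hp0 : ∀ i, 0 ≤ p i := fun i => by
    have := neg_abs_le (x i)
    simp only [hp]; linarith
  have hq0 : ∀ i, 0 ≤ q i := fun i => by
    have := le_abs_self (x i)
    simp only [hq]; linarith
  have hps : ∑ i, p i = 1 / 2 := by
    simp only [hp, ← Finset.sum_div, Finset.sum_add_distrib, hx, hx1]; norm_num
  have hqs : ∑ i, q i = 1 / 2 := by
    simp only [hq, ← Finset.sum_div, Finset.sum_sub_distrib, hx, hx1]; norm_num
  have hdecomp : ∀ k, (Aᵀ *ᵥ x) k = 2 * ∑ i, ∑ j, p i * q j * (A i k - A j k) := fun k => by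
    have h1 : ∑ i, ∑ j, p i * q j * A i k = 1 / 2 * ∑ i, p i * A i k := by
      rw [← hqs, Finset.sum_mul_sum, Finset.sum_comm]
      exact Finset.sum_congr rfl fun _ _ => Finset.sum_congr rfl fun _ _ => by ring
    have h2 : ∑ i, ∑ j, p i * q j * A j k = 1 / 2 * ∑ j, q j * A j k := by
      rw [← hps, Finset.sum_mul_sum]
      exact Finset.sum_congr rfl fun _ _ => Finset.sum_congr rfl fun _ _ => by ring
    simp only [mul_sub, Finset.sum_sub_distrib, h1, h2]
    have h3 : (Aᵀ *ᵥ x) k = ∑ i, p i * A i k - ∑ i, q i * A i k := by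
      rw [← Finset.sum_sub_distrib, Matrix.mulVec, dotProduct]
      refine Finset.sum_congr rfl fun i _ => ?_
      simp only [hp, hq, Matrix.transpose_apply]
      ring
    rw [h3]
    ring
  calc ∑ k, |(Aᵀ *ᵥ x) k|
      ≤ ∑ k, 2 * ∑ i, ∑ j, p i * q j * |A i k - A j k| := by
        refine Finset.sum_le_sum fun k _ => ?_
        rw [hdecomp, abs_mul, abs_two]
        gcongr
        refine (Finset.abs_sum_le_sum_abs _ _).trans (Finset.sum_le_sum fun i _ => ?_)
        refine (Finset.abs_sum_le_sum_abs _ _).trans (Finset.sum_le_sum fun j _ => ?_)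
        rw [abs_mul, abs_of_nonneg (mul_nonneg (hp0 i) (hq0 j))]
    _ = 2 * ∑ i, ∑ j, p i * q j * ∑ k, |A i k - A j k| := by
        rw [← Finset.mul_sum, Finset.sum_comm]
        congr 1
        refine Finset.sum_congr rfl fun i _ => ?_
        rw [Finset.sum_comm]
        simp only [Finset.mul_sum]
    _ ≤ 2 * ∑ i, ∑ j, p i * q j * M := by
        gcongr with i _ j _
        · exact mul_nonneg (hp0 i) (hq0 j)
        · exact hM i j
    _ = 1 / 2 * M := by
        simp only [← Finset.sum_mul, ← Finset.mul_sum, hps, hqs]; ring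

lemma exists_lpNorm_one_transpose_mulVec_eq {n : ℕ} (A : Matrix (Fin n) (Fin n) ℝ)
    {i j : Fin n} (hij : i ≠ j) :
    ∃ x : Fin n → ℝ, ∑ l, x l = 0 ∧ lpNorm 1 x = 1 ∧
      1 / 2 * ∑ k, |A i k - A j k| = lpNorm 1 (Aᵀ *ᵥ x) := by
  refine ⟨Pi.single i (1 / 2) - Pi.single j (1 / 2), ?_, ?_, ?_⟩
  · simp [Finset.sum_sub_distrib]
  · have habs : ∀ l, |(Pi.single i (1 / 2) - Pi.single j (1 / 2) : Fin n → ℝ) l| =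
        (Pi.single i (1 / 2) + Pi.single j (1 / 2) : Fin n → ℝ) l := fun l => by
      by_cases hi : l = i
      · subst hi; simp [hij]
      · by_cases hj : l = j
        · subst hj; simp [hij.symm]
        · simp [hi, hj]
    simp only [lpNorm_one_eq_sum, habs, Pi.add_apply, Finset.sum_add_distrib,
      Finset.sum_pi_single', Finset.mem_univ, if_true]
    norm_num
  · rw [lpNorm_one_eq_sum, Finset.mul_sum]
    refine Finset.sum_congr rfl fun k _ => ?_
    rw [Matrix.mulVec_sub, Matrix.mulVec_single, Matrix.mulVec_single]
    have h : |(1 / 2 : ℝ) * (A i k - A j k)| = 1 / 2 * |A i k - A j k| := by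
      rw [abs_mul, abs_of_pos one_half_pos]
    rw [← h]
    congr 1
    simp [Matrix.col]
    ring

lemma sum_min_eq_sub_half_sum_abs {ι : Type*} [Fintype ι] {f g : ι → ℝ} {c : ℝ}
    (hf : ∑ k, f k = c) (hg : ∑ k, g k = c) :
    ∑ k, min (f k) (g k) = c - 1 / 2 * ∑ k, |f k - g k| := by
  have h : ∀ k, min (f k) (g k) = (f k + g k - |f k - g k|) / 2 := fun k => by
    rcases le_total (f k) (g k) with h | h
    · rw [min_eq_left h, abs_of_nonpos (sub_nonpos.2 h)]; ring
    · rw [min_eq_right h, abs_of_nonneg (sub_nonneg.2 h)]; ring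
  simp only [h, ← Finset.sum_div, Finset.sum_sub_distrib, Finset.sum_add_distrib, hf, hg]
  ring

lemma ciInf_const_sub_eq {ι : Type*} [Finite ι] [Nonempty ι] (f : ι → ℝ) (c : ℝ) :
    ⨅ i, (c - f i) = c - ⨆ i, f i := by
  apply le_antisymm
  · rw [le_sub_comm]
    exact ciSup_le fun i => le_sub_comm.1 (ciInf_le (Set.finite_range _).bddBelow i)
  · exact le_ciInf fun i => sub_le_sub_left (le_ciSup (Set.finite_range f).bddAbove i) c

/-- Explicit form of `τ₁` for e-matrices (Theorem 2.1, first part). -/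
theorem tau_one_eq {n : ℕ} (hn : 2 ≤ n) (A : Matrix (Fin n) (Fin n) ℝ) (lamA : ℝ)
    (hrow : ∀ i, ∑ j, A i j = lamA) :
    tau 1 A = (1 / 2) * (⨆ i : Fin n, ⨆ j : Fin n, ∑ k, |A i k - A j k|) ∧
    tau 1 A = lamA - (⨅ i : Fin n, ⨅ j : Fin n, ∑ k, min (A i k) (A j k)) := by
  have : Nonempty (Fin n) := ⟨⟨0, by omega⟩⟩
  have hfirst : tau 1 A = 1 / 2 * ⨆ i : Fin n, ⨆ j : Fin n, ∑ k, |A i k - A j k| := by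
    have hle : ∀ i j, ∑ k, |A i k - A j k| ≤ ⨆ i : Fin n, ⨆ j : Fin n, ∑ k, |A i k - A j k| :=
      fun i j => (le_ciSup (f := fun j => ∑ k, |A i k - A j k|)
        (Set.finite_range _).bddAbove j).trans
        (le_ciSup (f := fun i => ⨆ j, ∑ k, |A i k - A j k|) (Set.finite_range _).bddAbove i)
    have hbound : ∀ y ∈ {y : ℝ | ∃ x : Fin n → ℝ, (∑ i, x i) = 0 ∧ lpNorm 1 x = 1 ∧
        y = lpNorm 1 (Aᵀ *ᵥ x)}, y ≤ 1 / 2 * ⨆ i : Fin n, ⨆ j : Fin n, ∑ k, |A i k - A j k| := by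
      rintro y ⟨x, hx, hx1, rfl⟩
      rw [lpNorm_one_eq_sum] at hx1 ⊢
      exact sum_abs_transpose_mulVec_le A hle hx hx1
    have hlower : ∀ i j, 1 / 2 * ∑ k, |A i k - A j k| ≤ tau 1 A := fun i j => by
      rcases eq_or_ne i j with rfl | hij
      · simp only [sub_self, abs_zero, Finset.sum_const_zero, mul_zero]
        refine Real.sSup_nonneg ?_
        rintro y ⟨x, -, -, rfl⟩
        rw [lpNorm_one_eq_sum]
        positivity
      · exact le_csSup ⟨_, hbound⟩ (exists_lpNorm_one_transpose_mulVec_eq A hij)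
    refine le_antisymm ?_ ?_
    · obtain ⟨x, hx⟩ := exists_lpNorm_one_transpose_mulVec_eq A
        (i := ⟨0, by omega⟩) (j := ⟨1, by omega⟩) (by simp)
      exact csSup_le ⟨_, x, hx⟩ hbound
    · have : (⨆ i : Fin n, ⨆ j : Fin n, ∑ k, |A i k - A j k|) ≤ 2 * tau 1 A :=
        ciSup_le fun i => ciSup_le fun j => by linarith [hlower i j]
      linarith
  refine ⟨hfirst, ?_⟩
  simp only [fun i j => sum_min_eq_sub_half_sum_abs (hrow i) (hrow j), ciInf_const_sub_eq,
    ← Real.mul_iSup_of_nonneg one_half_pos.le, hfirst, sub_sub_cancel]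
end

section
/- Let n ≥ 2 and let A = [a_{ij}] be a real n×n matrix with constant row sums. Then τ_∞(A) = ρ̂(A), where ρ̂(A) = max_{1≤j≤n} min_{x∈ℝ} Σ_{i=1}^n |a_{ij} − x|. -/
open Matrix Polynomial Filter
open scoped ENNReal

/-- The `l_∞` norm is the sup norm. -/
theorem lpNorm_top_eq_norm {n : ℕ} [Nonempty (Fin n)] (x : Fin n → ℝ) : lpNorm ⊤ x = ‖x‖ := by
  unfold lpNorm
  rw [PiLp.norm_eq_ciSup]
  refine le_antisymm (ciSup_le fun i => norm_le_pi_norm x i) ?_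
  refine (pi_norm_le_iff_of_nonempty _).2 fun i => ?_
  exact le_ciSup (f := fun i => ‖x i‖) (Set.finite_range _).bddAbove i

/-- Every finite family of reals has a median among its values. -/
theorem exists_median {ι : Type*} [Fintype ι] [Nonempty ι] (a : ι → ℝ) :
    ∃ k, 2 * (Finset.univ.filter fun i => a i < a k).card ≤ Fintype.card ι ∧
      2 * (Finset.univ.filter fun i => a k < a i).card ≤ Fintype.card ι := by
  classical
  have hsplit (t : ℝ) : (Finset.univ.filter fun i => a i ≤ t).card +
      (Finset.univ.filter fun i => t < a i).card = Fintype.card ι := by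
    simpa using Finset.card_filter_add_card_filter_not
      (s := (Finset.univ : Finset ι)) (fun i => a i ≤ t)
  let S := Finset.univ.filter fun k =>
    Fintype.card ι ≤ 2 * (Finset.univ.filter fun i => a i ≤ a k).card
  have hS : S.Nonempty := by
    obtain ⟨m, hm⟩ := Finite.exists_max a
    refine ⟨m, Finset.mem_filter.2 ⟨Finset.mem_univ _, ?_⟩⟩
    rw [Finset.filter_true_of_mem fun i _ => hm i, Finset.card_univ]
    omega
  obtain ⟨k, hkS, hk⟩ := S.exists_min_image a hS
  have hkc := (Finset.mem_filter.1 hkS).2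
  refine ⟨k, ?_, by have := hsplit (a k); omega⟩
  rcases (Finset.univ.filter fun i => a i < a k).eq_empty_or_nonempty with h | h
  · simp [h]
  obtain ⟨m, hm, hmax⟩ := Finset.exists_max_image _ a h
  have hmk : a m < a k := (Finset.mem_filter.1 hm).2
  have hmS : m ∉ S := fun hmS => (hk m hmS).not_gt hmk
  have hlt : 2 * (Finset.univ.filter fun i => a i ≤ a m).card < Fintype.card ι := by
    simpa [S] using hmS
  have hle : (Finset.univ.filter fun i => a i < a k).card ≤
      (Finset.univ.filter fun i => a i ≤ a m).card :=
    Finset.card_le_card fun i hi => Finset.mem_filter.2 ⟨Finset.mem_univ _, hmax i hi⟩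
  omega

/-- There is a zero-sum vector in the unit cube whose pairing with `a` is the sum of the absolute
deviations of `a` from a median. -/
theorem exists_sum_eq_zero_sum_mul_eq_sum_abs_sub {ι : Type*} [Fintype ι] [Nonempty ι]
    (a : ι → ℝ) : ∃ (t : ℝ) (x : ι → ℝ), ∑ i, x i = 0 ∧ (∀ i, |x i| ≤ 1) ∧
      ((∃ i, a i ≠ t) → ∃ i, |x i| = 1) ∧ ∑ i, a i * x i = ∑ i, |a i - t| := by
  classical
  obtain ⟨k, h1, h2⟩ := exists_median a
  set L := (Finset.univ.filter fun i => a i < a k).card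
  set G := (Finset.univ.filter fun i => a k < a i).card
  set E := (Finset.univ.filter fun i => a i = a k).card
  have hE : 0 < E := Finset.card_pos.2 ⟨k, by simp⟩
  have hcard : (L + G + E : ℝ) = Fintype.card ι := by
    simp only [L, G, E, Finset.card_filter, Nat.cast_sum, Nat.cast_ite, Nat.cast_one,
      Nat.cast_zero, ← Finset.sum_add_distrib]
    rw [← Finset.card_univ, Finset.cast_card]
    refine Finset.sum_congr rfl fun i _ => ?_
    rcases lt_trichotomy (a i) (a k) with h | h | h
    · simp [h, h.ne, h.not_gt]
    · simp [h]
    · simp [h, h.ne', h.not_gt]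
  have hE' : (0 : ℝ) < E := by exact_mod_cast hE
  have h1' : (2 * L : ℝ) ≤ Fintype.card ι := by exact_mod_cast h1
  have h2' : (2 * G : ℝ) ≤ Fintype.card ι := by exact_mod_cast h2
  let s : ℝ := (L - G) / E
  have hs : |s| ≤ 1 := by
    rw [abs_div, abs_of_pos hE', div_le_one hE', abs_le]
    constructor <;> linarith
  let x : ι → ℝ := fun i => if a i < a k then -1 else if a k < a i then 1 else s
  have hx0 : ∑ i, x i = 0 := by
    have hx : ∀ i, x i = (if a k < a i then 1 else 0) - (if a i < a k then 1 else 0)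
        + s * (if a i = a k then 1 else 0) := by
      intro i
      rcases lt_trichotomy (a i) (a k) with h | h | h
      · simp [x, h, h.ne, h.not_gt]
      · simp [x, h]
      · simp [x, h, h.ne', h.not_gt]
    simp_rw [hx, Finset.sum_add_distrib, Finset.sum_sub_distrib, ← Finset.mul_sum,
      Finset.sum_boole]
    change (G - L : ℝ) + (L - G) / E * E = 0
    rw [div_mul_cancel₀ _ hE'.ne']
    ring
  refine ⟨a k, x, hx0, fun i => ?_, ?_, ?_⟩
  · dsimp only [x]
    split_ifs <;> simp [hs]
  · rintro ⟨i, hi⟩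
    refine ⟨i, ?_⟩
    rcases hi.lt_or_gt with h | h
    · simp [x, h]
    · simp [x, h, h.not_gt]
  · calc ∑ i, a i * x i = ∑ i, (a i - a k) * x i := by
          simp_rw [sub_mul, Finset.sum_sub_distrib, ← Finset.mul_sum, hx0]
          simp
      _ = _ := by
          refine Finset.sum_congr rfl fun i _ => ?_
          rcases lt_trichotomy (a i) (a k) with h | h | h
          · simp [x, h, abs_of_neg]
          · simp [h]
          · simp [x, h, h.not_gt, abs_of_pos]

/-- Explicit form of `τ_∞` for e-matrices (Theorem 2.1, second part). -/
theorem tau_infty_eq {n : ℕ} (hn : 2 ≤ n) (A : Matrix (Fin n) (Fin n) ℝ) (c : ℝ)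
    (hrow : ∀ i, ∑ j, A i j = c) :
    tau ⊤ A = ⨆ j : Fin n, ⨅ x : ℝ, ∑ i, |A i j - x| := by
  have : Nonempty (Fin n) := ⟨⟨0, by omega⟩⟩
  unfold tau
  simp only [lpNorm_top_eq_norm]
  set T := {y : ℝ | ∃ x : Fin n → ℝ, (∑ i, x i) = 0 ∧ ‖x‖ = 1 ∧ y = ‖Aᵀ *ᵥ x‖}
  have hmul (x : Fin n → ℝ) (j : Fin n) : (Aᵀ *ᵥ x) j = ∑ i, A i j * x i := rfl
  have hub : ∀ y ∈ T, y ≤ ⨆ j : Fin n, ⨅ x : ℝ, ∑ i, |A i j - x| := by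
    rintro y ⟨x, hx0, hx1, rfl⟩
    refine (pi_norm_le_iff_of_nonempty _).2 fun j => ?_
    refine le_trans (le_ciInf fun t => ?_)
      (le_ciSup (f := fun j : Fin n => ⨅ x : ℝ, ∑ i, |A i j - x|) (Set.finite_range _).bddAbove j)
    have hshift : ∑ i, A i j * x i = ∑ i, (A i j - t) * x i := by
      simp_rw [sub_mul, Finset.sum_sub_distrib, ← Finset.mul_sum, hx0]
      simp
    rw [hmul, hshift, Real.norm_eq_abs]
    refine (Finset.abs_sum_le_sum_abs _ _).trans (Finset.sum_le_sum fun i _ => ?_)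
    rw [abs_mul]
    exact mul_le_of_le_one_right (abs_nonneg _) (hx1 ▸ norm_le_pi_norm x i)
  have hT : T.Nonempty := by
    let p : Fin n := ⟨0, by omega⟩
    let q : Fin n := ⟨1, by omega⟩
    have hpq : p ≠ q := by simp [p, q]
    let x : Fin n → ℝ := Pi.single p 1 - Pi.single q 1
    refine ⟨_, x, by simp [x], le_antisymm ?_ ?_, rfl⟩
    · refine (pi_norm_le_iff_of_nonempty _).2 fun i => ?_
      by_cases hp : i = p
      · simp [x, hp, hpq]
      · by_cases hq : i = q <;> simp [x, hp, hq, hpq.symm]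
    · simpa [x, hpq] using norm_le_pi_norm x p
  refine le_antisymm (csSup_le hT hub) (ciSup_le fun j => ?_)
  obtain ⟨t, x, hx0, hx1, hx, hsum⟩ := exists_sum_eq_zero_sum_mul_eq_sum_abs_sub fun i => A i j
  have hbdd : BddBelow (Set.range fun t : ℝ => ∑ i, |A i j - t|) :=
    ⟨0, by rintro _ ⟨t, rfl⟩; positivity⟩
  refine (ciInf_le hbdd t).trans ?_
  by_cases h : ∃ i, A i j ≠ t
  · obtain ⟨m, hm⟩ := hx h
    have hnorm : ‖x‖ = 1 := le_antisymm ((pi_norm_le_iff_of_nonempty _).2 hx1)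
      (hm ▸ norm_le_pi_norm x m)
    calc ∑ i, |A i j - t| = (Aᵀ *ᵥ x) j := by rw [hmul, hsum]
      _ ≤ ‖Aᵀ *ᵥ x‖ := (le_abs_self _).trans (norm_le_pi_norm (Aᵀ *ᵥ x) j)
      _ ≤ sSup T := le_csSup ⟨_, hub⟩ ⟨x, hx0, hnorm, rfl⟩
  · push Not at h
    simp only [h, sub_self, abs_zero, Finset.sum_const_zero]
    refine Real.sSup_nonneg ?_
    rintro _ ⟨x, -, -, rfl⟩
    exact norm_nonneg _
end

section
/- Let p ∈ [1,∞], let A be a real n×n matrix with constant row sums, and let B be any real n×n matrix. Then τ_p(AB) ≤ τ_p(A) · τ_p(B). -/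
open Matrix Polynomial Filter
open scoped ENNReal

section Bound

variable {n : ℕ} {p : ℝ≥0∞} (A : Matrix (Fin n) (Fin n) ℝ)

theorem lpNorm_smul (hp : 1 ≤ p) (r : ℝ) (x : Fin n → ℝ) :
    lpNorm p (r • x) = |r| * lpNorm p x := by
  have : Fact (1 ≤ p) := ⟨hp⟩
  simp [lpNorm, WithLp.toLp_smul, norm_smul]

theorem lpNorm_nonneg (hp : 1 ≤ p) (x : Fin n → ℝ) : 0 ≤ lpNorm p x := by
  have : Fact (1 ≤ p) := ⟨hp⟩
  exact norm_nonneg _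

theorem lpNorm_eq_zero (hp : 1 ≤ p) {x : Fin n → ℝ} : lpNorm p x = 0 ↔ x = 0 := by
  have : Fact (1 ≤ p) := ⟨hp⟩
  simp [lpNorm]

/-- A matrix acts boundedly with respect to the `l_p` norm. -/
theorem exists_lpNorm_mulVec_le (hp : 1 ≤ p) :
    ∃ C, ∀ x : Fin n → ℝ, lpNorm p (A *ᵥ x) ≤ C * lpNorm p x := by
  have : Fact (1 ≤ p) := ⟨hp⟩
  let e := WithLp.linearEquiv p ℝ (Fin n → ℝ)
  let f := LinearMap.toContinuousLinearMap
    (e.symm.toLinearMap ∘ₗ A.mulVecLin ∘ₗ e.toLinearMap)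
  exact ⟨‖f‖, fun x ↦ f.le_opNorm (WithLp.toLp p x)⟩

theorem tau_nonneg (hp : 1 ≤ p) : 0 ≤ tau p A := by
  apply Real.sSup_nonneg
  rintro _ ⟨x, -, -, rfl⟩
  exact lpNorm_nonneg hp _

theorem lpNorm_transpose_mulVec_le_tau (hp : 1 ≤ p) {x : Fin n → ℝ}
    (hx : ∑ i, x i = 0) : lpNorm p (Aᵀ *ᵥ x) ≤ tau p A * lpNorm p x := by
  rcases (lpNorm_nonneg hp x).eq_or_lt with h | h
  · have hx0 := (lpNorm_eq_zero hp).1 h.symm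
    simp [hx0, (lpNorm_eq_zero hp).2]
  · obtain ⟨C, hC⟩ := exists_lpNorm_mulVec_le Aᵀ hp
    rw [← div_le_iff₀ h]
    refine le_csSup ⟨C, ?_⟩ ⟨(lpNorm p x)⁻¹ • x, ?_, ?_, ?_⟩
    · rintro _ ⟨y, -, hy, rfl⟩
      simpa [hy] using hC y
    · simp [← Finset.mul_sum, hx]
    · rw [lpNorm_smul hp, abs_of_pos (inv_pos.2 h), inv_mul_cancel₀ h.ne']
    · rw [mulVec_smul, lpNorm_smul hp, abs_of_pos (inv_pos.2 h), div_eq_inv_mul]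

/-- The transpose of a matrix with constant row sums preserves the zero-sum vectors. -/
theorem sum_transpose_mulVec_eq_zero {c : ℝ} (hrow : ∀ i, ∑ j, A i j = c)
    {x : Fin n → ℝ} (hx : ∑ i, x i = 0) : ∑ i, (Aᵀ *ᵥ x) i = 0 := by
  simp only [mulVec, dotProduct, transpose_apply]
  rw [Finset.sum_comm]
  simp [← Finset.sum_mul, hrow, ← Finset.mul_sum, hx]

end Bound

/-- Submultiplicativity of `τ_p` when the left factor is an e-matrix. -/
theorem tau_mul_le {n : ℕ} (p : ℝ≥0∞) (hp : 1 ≤ p) (A B : Matrix (Fin n) (Fin n) ℝ)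
    (c : ℝ) (hrow : ∀ i, ∑ j, A i j = c) :
    tau p (A * B) ≤ tau p A * tau p B := by
  apply Real.sSup_le
  · rintro _ ⟨x, hx, hx1, rfl⟩
    rw [transpose_mul, ← mulVec_mulVec]
    calc
      lpNorm p (Bᵀ *ᵥ Aᵀ *ᵥ x) ≤ tau p B * lpNorm p (Aᵀ *ᵥ x) :=
        lpNorm_transpose_mulVec_le_tau B hp (sum_transpose_mulVec_eq_zero A hrow hx)
      _ ≤ tau p B * (tau p A * lpNorm p x) :=
        mul_le_mul_of_nonneg_left (lpNorm_transpose_mulVec_le_tau A hp hx) (tau_nonneg B hp)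
      _ = tau p A * tau p B := by rw [hx1, mul_one, mul_comm]
  · exact mul_nonneg (tau_nonneg A hp) (tau_nonneg B hp)
end

section
/- Let A be a real n×n matrix with constant row sums, n ≥ 2, with trivial eigenvalue λ_A equal to the common row sum. If λ_A is not a simple eigenvalue of A (i.e., its algebraic multiplicity as a root of the characteristic polynomial is at least 2), then there exists a left eigenvector v ∈ ℂⁿ of A associated with λ_A (vᵀA = λ_A vᵀ, v ≠ 0) such that vᵀe = 0, where e is the all-ones vector. -/
open Matrix Polynomial Filter
open scoped ENNReal

/-- If a linear functional `φ` is a left eigenvector of `f` for an eigenvalue `μ` of algebraic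
multiplicity at least `2`, then some eigenvector of `f` for `μ` lies in the kernel of `φ`. -/
theorem Module.End.exists_eigenvector_mem_ker {K V : Type*} [Field K] [AddCommGroup V] [Module K V]
    [FiniteDimensional K V] (f : Module.End K V) (μ : K) (φ : V →ₗ[K] K)
    (hφ : ∀ x, φ (f x) = μ * φ x) (hμ : 2 ≤ f.charpoly.rootMultiplicity μ) :
    ∃ v, v ≠ 0 ∧ f v = μ • v ∧ φ v = 0 := by
  rw [← LinearMap.finrank_maxGenEigenspace_eq] at hμ
  have hker : LinearMap.ker (φ ∘ₗ (f.maxGenEigenspace μ).subtype) ≠ ⊥ :=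
    LinearMap.ker_ne_bot_of_finrank_lt (by rw [Module.finrank_self]; omega)
  obtain ⟨⟨w, hwG⟩, hwφ, hw⟩ := Submodule.exists_mem_ne_zero_of_ne_bot hker
  have hwφ : φ w = 0 := by simpa using hwφ
  have hw : w ≠ 0 := by simpa using hw
  obtain ⟨k, hk⟩ := Module.End.mem_maxGenEigenspace f μ w |>.1 hwG
  induction k generalizing w with
  | zero => exact absurd (by simpa using hk) hw
  | succ k ih =>
    by_cases h : (f - μ • 1) w = 0
    · exact ⟨w, hw, by simpa [sub_eq_zero] using h, hwφ⟩
    · have hk' : ((f - μ • 1) ^ k) ((f - μ • 1) w) = 0 := by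
        rwa [pow_succ, Module.End.mul_apply] at hk
      have hφ' : φ ((f - μ • 1) w) = 0 := by simp [hφ, hwφ]
      have hG := (Module.End.mem_maxGenEigenspace f μ _).2 ⟨k, hk'⟩
      exact ih _ hG (by simpa using hφ') (by simpa using h) hφ' h hk'

/-- If the trivial eigenvalue of an e-matrix is not simple, some associated left
eigenvector is orthogonal to the all-ones vector (Lemma 2.9 (2)). -/
theorem exists_left_eigenvector_orthogonal {n : ℕ} (hn : 2 ≤ n)
    (A : Matrix (Fin n) (Fin n) ℝ) (lamA : ℝ) (hrow : ∀ i, ∑ j, A i j = lamA)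
    (hmult : 2 ≤ (A.map fun r => (r : ℂ)).charpoly.rootMultiplicity (lamA : ℂ)) :
    ∃ v : Fin n → ℂ, v ≠ 0 ∧ v ᵥ* (A.map fun r => (r : ℂ)) = (lamA : ℂ) • v ∧
      ∑ i, v i = 0 := by
  obtain ⟨v, hv, hev, hsum⟩ := Module.End.exists_eigenvector_mem_ker
    (Matrix.toLin' (A.map fun r => (r : ℂ))ᵀ) (lamA : ℂ) (∑ i, LinearMap.proj i)
    (fun x => by
      have hrow' : ∀ i, ∑ j, (A i j : ℂ) = lamA := fun i => by rw [← hrow i]; push_cast; rfl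
      simp only [LinearMap.sum_apply, LinearMap.proj_apply, Matrix.toLin'_apply, Matrix.mulVec,
        dotProduct, Matrix.transpose_apply, Matrix.map_apply]
      rw [Finset.sum_comm, Finset.mul_sum]
      simp_rw [← Finset.sum_mul, hrow'])
    (by rwa [Matrix.charpoly_toLin', Matrix.charpoly_transpose])
  refine ⟨v, hv, ?_, by simpa using hsum⟩
  rwa [Matrix.toLin'_apply, Matrix.mulVec_transpose] at hev
end

section
/- Let A be a real n×n matrix with constant row sums, n ≥ 2, with trivial eigenvalue λ_A equal to the common row sum, let α ∈ ℝ, and let J be the n×n all-ones matrix. Write the characteristic polynomial of A over ℂ as char(A) = (X − λ_A)·q(X). Then the characteristic polynomial of B = A + αJ over ℂ is char(B) = (X − (λ_A + nα))·q(X); in particular B is an e-matrix with trivial eigenvalue λ_A + nα, and the remaining eigenvalues of B, counted with multiplicity, coincide with those of A. -/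
open Matrix Polynomial Filter
open scoped ENNReal

/-- If all row sums of `M` equal `s`, then `s` is a factor of `det M`: the cofactor is the determinant
of `M` with one column replaced by ones. -/
theorem det_eq_mul_det_updateCol_one {ι R : Type*} [Fintype ι] [DecidableEq ι] [CommRing R]
    (M : Matrix ι ι R) (s : R) (hM : ∀ i, ∑ j, M i j = s) (k : ι) :
    M.det = s * (M.updateCol k 1).det := by
  have h := det_updateCol_sum M k (fun _ => 1)
  rw [one_smul] at h
  rw [← h, ← det_updateCol_smul]
  congr 2
  ext i
  simp [hM]

/-- Adding a constant to all entries does not change the determinant of a matrix having a column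
of ones. -/
theorem det_updateCol_one_add_const {ι R : Type*} [Fintype ι] [DecidableEq ι] [CommRing R]
    (M : Matrix ι ι R) (c : R) (k : ι) :
    ((M + Matrix.of fun _ _ => c).updateCol k 1).det = (M.updateCol k 1).det := by
  rw [← det_transpose, ← det_transpose (M.updateCol k 1)]
  refine det_eq_of_forall_row_eq_smul_add_const (fun j => if j = k then 0 else c) k (by simp) ?_
  intro j i
  by_cases hj : j = k <;> simp [hj]

/-- Brauer-type deflation: adding `α J` to an e-matrix shifts the trivial eigenvalue to
`λ_A + n α` and fixes the remaining eigenvalues with multiplicity (Lemma 2.17). -/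
theorem charpoly_add_smul_allOnes {n : ℕ} (hn : 2 ≤ n) (A : Matrix (Fin n) (Fin n) ℝ)
    (lamA : ℝ) (hrow : ∀ i, ∑ j, A i j = lamA) (α : ℝ) (q : Polynomial ℂ)
    (hq : (A.map fun r => (r : ℂ)).charpoly = (X - C (lamA : ℂ)) * q) :
    (((A + α • allOnes n).map fun r => (r : ℂ)).charpoly
        = (X - C ((lamA : ℂ) + n * α)) * q) ∧
    (∀ i, ∑ j, (A + α • allOnes n) i j = lamA + n * α) := by
  have : NeZero n := ⟨by omega⟩
  refine ⟨?_, fun i => by simp [allOnes, Finset.sum_add_distrib, hrow]⟩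
  have hsum (i : Fin n) :
      ∑ j, charmatrix (A.map fun r => (r : ℂ)) i j = X - C (lamA : ℂ) := by
    simp only [charmatrix_apply, Finset.sum_sub_distrib, diagonal_apply, Finset.sum_ite_eq,
      Finset.mem_univ, if_true, Matrix.map_apply, ← hrow i, Complex.ofReal_sum, map_sum]
  have hadd : charmatrix ((A + α • allOnes n).map fun r => (r : ℂ)) =
      charmatrix (A.map fun r => (r : ℂ)) + Matrix.of fun _ _ => -C (α : ℂ) := by
    ext1 i j
    simp [charmatrix_apply, allOnes]
    ring
  have hsum' (i : Fin n) :
      ∑ j, charmatrix ((A + α • allOnes n).map fun r => (r : ℂ)) i j =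
        X - C ((lamA : ℂ) + n * α) := by
    simp only [hadd, Matrix.add_apply, Finset.sum_add_distrib, hsum, of_apply, Finset.sum_const,
      Finset.card_univ, Fintype.card_fin, nsmul_eq_mul, map_add, map_mul, map_natCast]
    ring
  have hdet : (charmatrix (A.map fun r => (r : ℂ))).det = (X - C (lamA : ℂ)) * q := hq
  rw [det_eq_mul_det_updateCol_one _ _ hsum 0] at hdet
  rw [Matrix.charpoly, det_eq_mul_det_updateCol_one _ _ hsum' 0, hadd,
    det_updateCol_one_add_const, mul_left_cancel₀ (X_sub_C_ne_zero _) hdet]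
end
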